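/- Let λ ∈ [0,1), F a λ-regular CDF with density on [a,b) ⊆ [0,∞), and n ≥ j ≥ 1 integers. Let u_j = E[v^{(1,⌈n/j⌉)}] be finite. Then n·(1 − F(u_j)) ≥ (j/2)·c(λ); that is, if v is a single draw from F, then n·P[v ≥ u_j] ≥ (j/2)·c(λ). -/

import Mathlib

open MeasureTheory Filter

/-- The `j`-th largest value (1-indexed) among the `t` coordinates of `v`. -/
noncomputable def orderStat (t j : ℕ) (v : Fin t → ℝ) : ℝ :=
  ((List.ofFn v).insertionSort (· ≤ ·)).getD (t - j) 0

/-- The expectation of the `j`-th largest of `t` i.i.d. draws from `μ`. -/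
noncomputable def orderStatExp (μ : Measure ℝ) (j t : ℕ) : ℝ :=
  ∫ v, orderStat t j v ∂(Measure.pi fun _ : Fin t => μ)

/-- `F` is a CDF with density `f` on `[a, b)` (where possibly `b = ∞`):
differentiable with positive derivative `f` there, `F a = 0`, `F` nondecreasing,
and `F x → 1` as `x → b`. -/
def IsCDF (F f : ℝ → ℝ) (a : ℝ) (b : EReal) : Prop :=
  (a : EReal) < b ∧ Monotone F ∧ F a = 0 ∧
  (∀ x : ℝ, a ≤ x → (x : EReal) < b → HasDerivAt F (f x) x ∧ 0 < f x) ∧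
  Tendsto F (Filter.comap (fun x : ℝ => (x : EReal)) (nhdsWithin b (Set.Iio b))) (nhds 1)

/-- `μ` is the probability measure on `[a, b)` induced by the CDF `F`. -/
def InducedBy (μ : Measure ℝ) (F : ℝ → ℝ) (a : ℝ) (b : EReal) : Prop :=
  IsProbabilityMeasure μ ∧
  ∀ x : ℝ, a ≤ x → (x : EReal) < b → μ (Set.Iic x) = ENNReal.ofReal (F x)

/-- `λ`-regularity of the CDF `F` with density `f` on `[a, b)`. -/
def LambdaRegular (l : ℝ) (F f : ℝ → ℝ) (a : ℝ) (b : EReal) : Prop :=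
  MonotoneOn (fun v => l * v - (1 - F v) / f v) {x : ℝ | a ≤ x ∧ (x : EReal) < b}

/-- `c(λ) = (1 - λ)^(1/λ)` for `λ ∈ (0,1]`, with `c(0) = 1/e`. -/
noncomputable def cReg (l : ℝ) : ℝ := if l = 0 then (Real.exp 1)⁻¹ else (1 - l) ^ (1 / l)

lemma orderStat_one_le_iff {t : ℕ} (ht : 0 < t) (v : Fin t → ℝ) (x : ℝ) :
    orderStat t 1 v ≤ x ↔ ∀ i, v i ≤ x := by
  set l := (List.ofFn v).insertionSort (· ≤ ·) with hl
  have hlen : l.length = t := by simp [hl]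
  have hmem : ∀ y, y ∈ l ↔ ∃ i, v i = y := fun y => by
    simp [hl, List.mem_insertionSort, List.mem_ofFn]
  have hlt : t - 1 < l.length := by omega
  have hval : orderStat t 1 v = l[t - 1] := by
    rw [orderStat, ← hl, List.getD_eq_getElem _ _ hlt]
  have hsorted : l.Pairwise (· ≤ ·) := List.pairwise_insertionSort _ _
  rw [hval]
  constructor
  · intro h i
    obtain ⟨k, hk, hki⟩ := List.mem_iff_getElem.1 ((hmem (v i)).2 ⟨i, rfl⟩)
    rw [← hki]
    refine le_trans ?_ h
    rcases Nat.lt_or_ge k (t - 1) with h' | h'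
    · exact List.pairwise_iff_getElem.1 hsorted k (t - 1) hk hlt h'
    · have : k = t - 1 := by omega
      subst this
      exact le_rfl
  · intro h
    obtain ⟨i, hi⟩ := (hmem _).1 (List.getElem_mem hlt)
    rw [← hi]
    exact h i

lemma preimage_orderStat_one_Iic {t : ℕ} (ht : 0 < t) (x : ℝ) :
    orderStat t 1 ⁻¹' Set.Iic x = Set.pi Set.univ fun _ => Set.Iic x := by
  ext v
  simp only [Set.mem_preimage, Set.mem_Iic, Set.mem_pi, Set.mem_univ, true_imp_iff,
    orderStat_one_le_iff ht]

lemma measurable_orderStat_one {t : ℕ} (ht : 0 < t) : Measurable (orderStat t 1) := by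
  refine measurable_of_Iic fun x => ?_
  rw [preimage_orderStat_one_Iic ht]
  exact MeasurableSet.univ_pi fun _ => measurableSet_Iic

lemma map_orderStat_one_Iic {t : ℕ} (ht : 0 < t) (μ : Measure ℝ) [IsProbabilityMeasure μ]
    (x : ℝ) :
    (Measure.pi fun _ : Fin t => μ).map (orderStat t 1) (Set.Iic x) = μ (Set.Iic x) ^ t := by
  rw [Measure.map_apply (measurable_orderStat_one ht) measurableSet_Iic,
    preimage_orderStat_one_Iic ht, Measure.pi_pi]
  simp

section CDF

variable {F f : ℝ → ℝ} {a : ℝ} {b : EReal}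

lemma IsCDF.exists_between (hF : IsCDF F f a b) {y : ℝ} (hy : y < 1) :
    ∃ x : ℝ, a ≤ x ∧ (x : EReal) < b ∧ y < F x := by
  obtain ⟨hab, -, -, -, hlim⟩ := hF
  have h1 := hlim.eventually (lt_mem_nhds hy)
  rw [eventually_comap] at h1
  obtain ⟨c, hc, hcb⟩ := (mem_nhdsLT_iff_exists_Ioo_subset' hab).1 h1
  obtain ⟨x, hx1, hx2⟩ := EReal.lt_iff_exists_real_btwn.1 (max_lt hc hab)
  exact ⟨x, by exact_mod_cast (le_max_right _ _).trans hx1.le, hx2,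
    hcb ⟨(le_max_left _ _).trans_lt hx1, hx2⟩ x rfl⟩

lemma IsCDF.lt_of_lt (hF : IsCDF F f a b) {x z : ℝ} (hx : a ≤ x) (hxb : (x : EReal) < b)
    (hxz : x < z) : F x < F z := by
  obtain ⟨-, hmono, -, hder, -⟩ := hF
  obtain ⟨w, hw1, hw2⟩ := EReal.lt_iff_exists_real_btwn.1
    (lt_min hxb (EReal.coe_lt_coe_iff.2 hxz))
  have hxw : x < w := by exact_mod_cast hw1
  have hwb : (w : EReal) < b := hw2.trans_le (min_le_left _ _)
  have hwz : w ≤ z := by exact_mod_cast (hw2.trans_le (min_le_right _ _)).le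
  have hd : ∀ y ∈ Set.Icc x w, HasDerivAt F (f y) y ∧ 0 < f y := fun y hy =>
    hder y (hx.trans hy.1) ((EReal.coe_le_coe_iff.2 hy.2).trans_lt hwb)
  have hs : StrictMonoOn F (Set.Icc x w) := by
    refine strictMonoOn_of_deriv_pos (convex_Icc _ _)
      (fun y hy => (hd y hy).1.continuousAt.continuousWithinAt) fun y hy => ?_
    have := hd y (interior_subset hy)
    rw [this.1.deriv]
    exact this.2
  exact (hs ⟨le_rfl, hxw.le⟩ ⟨hxw.le, le_rfl⟩ hxw).trans_le (hmono hwz)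

lemma IsCDF.lt_one (hF : IsCDF F f a b) {x : ℝ} (hx : a ≤ x) (hxb : (x : EReal) < b) :
    F x < 1 := by
  by_contra! h
  obtain ⟨w, hw1, hw2⟩ := EReal.lt_iff_exists_real_btwn.1 hxb
  have hxw : x < w := by exact_mod_cast hw1
  have hlt := hF.lt_of_lt hx hxb hxw
  obtain ⟨-, hmono, -, -, hlim⟩ := hF
  have h1 := hlim.eventually (gt_mem_nhds (h.trans_lt hlt))
  rw [eventually_comap] at h1
  obtain ⟨c, hc, hcb⟩ := (mem_nhdsLT_iff_exists_Ioo_subset' hw2).1 h1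
  obtain ⟨y, hy1, hy2⟩ := EReal.lt_iff_exists_real_btwn.1 (max_lt hc hw2)
  have h2 : F y < F w := hcb ⟨(le_max_left _ _).trans_lt hy1, hy2⟩ y rfl
  have h3 : w ≤ y := by exact_mod_cast (le_max_right _ _).trans hy1.le
  exact absurd (hmono h3) (not_le.2 h2)

lemma IsCDF.one_le (hF : IsCDF F f a b) {x : ℝ} (hxb : b ≤ (x : EReal)) : 1 ≤ F x := by
  by_contra! h
  obtain ⟨w, -, hwb, hw⟩ := hF.exists_between h
  exact absurd (hF.2.1 (show w ≤ x by exact_mod_cast hwb.le.trans hxb)) (not_le.2 hw)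

lemma IsCDF.exists_eq (hF : IsCDF F f a b) {y : ℝ} (hy0 : 0 ≤ y) (hy : y < 1) :
    ∃ x : ℝ, a ≤ x ∧ (x : EReal) < b ∧ F x = y := by
  obtain ⟨w, haw, hwb, hw⟩ := hF.exists_between hy
  obtain ⟨-, -, hFa, hder, -⟩ := hF
  have hc : ContinuousOn F (Set.Icc a w) := fun x hx =>
    (hder x hx.1 ((EReal.coe_le_coe_iff.2 hx.2).trans_lt hwb)).1.continuousAt.continuousWithinAt
  obtain ⟨x, hx, hxy⟩ := intermediate_value_Icc haw hc ⟨hFa.trans_le hy0, hw.le⟩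
  exact ⟨x, hx.1, (EReal.coe_le_coe_iff.2 hx.2).trans_lt hwb, hxy⟩

/-- `F` truncated to `[0, 1]` and raised to the power `t`: the CDF of the maximum of `t` draws. -/
noncomputable def maxCDF (F : ℝ → ℝ) (t : ℕ) (x : ℝ) : ℝ := max (min (F x) 1) 0 ^ t

lemma maxCDF_nonneg (F : ℝ → ℝ) (t : ℕ) (x : ℝ) : 0 ≤ maxCDF F t x :=
  pow_nonneg (le_max_right _ _) _

lemma maxCDF_le_one (F : ℝ → ℝ) (t : ℕ) (x : ℝ) : maxCDF F t x ≤ 1 :=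
  pow_le_one₀ (le_max_right _ _) (max_le (min_le_right _ _) zero_le_one)

lemma IsCDF.nonneg (hF : IsCDF F f a b) {x : ℝ} (hx : a ≤ x) : 0 ≤ F x :=
  hF.2.2.1.symm.le.trans (hF.2.1 hx)

lemma IsCDF.maxCDF_eq (hF : IsCDF F f a b) (t : ℕ) {x : ℝ} (hx : a ≤ x) (hxb : (x : EReal) < b) :
    maxCDF F t x = F x ^ t := by
  rw [maxCDF, min_eq_left (hF.lt_one hx hxb).le, max_eq_left (hF.nonneg hx)]

lemma IsCDF.monotone_maxCDF (hF : IsCDF F f a b) (t : ℕ) : Monotone (maxCDF F t) :=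
  fun _ _ h => pow_le_pow_left₀ (le_max_right _ _)
    (max_le_max_right _ (min_le_min_right _ (hF.2.1 h))) _

lemma IsCDF.maxCDF_lt (hF : IsCDF F f a b) {t : ℕ} (ht : 0 < t) {x z : ℝ} (hx : a ≤ x)
    (hxb : (x : EReal) < b) (hxz : x < z) : maxCDF F t x < maxCDF F t z := by
  refine pow_lt_pow_left₀ ?_ (le_max_right _ _) ht.ne'
  rw [min_eq_left (hF.lt_one hx hxb).le, max_eq_left (hF.nonneg hx)]
  exact lt_max_of_lt_left (lt_min (hF.lt_of_lt hx hxb hxz) (hF.lt_one hx hxb))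

/-- Probability integral transform for the maximum of `t` draws. -/
lemma IsCDF.map_maxCDF (hF : IsCDF F f a b) {t : ℕ} (ht : 0 < t) {ρ : Measure ℝ}
    [IsProbabilityMeasure ρ]
    (hρ : ∀ x : ℝ, a ≤ x → (x : EReal) < b → ρ (Set.Iic x) = ENNReal.ofReal (F x ^ t)) :
    ρ.map (maxCDF F t) = volume.restrict (Set.Icc 0 1) := by
  have hmeas := (hF.monotone_maxCDF t).measurable
  have := Measure.isProbabilityMeasure_map (μ := ρ) hmeas.aemeasurable
  refine Measure.ext_of_Iic _ _ fun y => ?_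
  rw [Measure.map_apply hmeas measurableSet_Iic, Measure.restrict_apply measurableSet_Iic]
  rcases lt_or_ge y 0 with hy | hy
  · have h1 : maxCDF F t ⁻¹' Set.Iic y = ∅ := by
      ext z
      simpa using hy.trans_le (maxCDF_nonneg F t z)
    have h2 : Set.Iic y ∩ Set.Icc 0 1 = ∅ := by
      ext z
      simp only [Set.mem_inter_iff, Set.mem_Iic, Set.mem_Icc, Set.mem_empty_iff_false, iff_false]
      intro h
      linarith [h.1, h.2.1]
    rw [h1, h2, measure_empty, measure_empty]
  rcases lt_or_ge y 1 with hy1 | hy1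
  · obtain ⟨x, hx, hxb, hxy⟩ := hF.exists_eq (y := y ^ (t : ℝ)⁻¹) (Real.rpow_nonneg hy _)
      (Real.rpow_lt_one hy hy1 (by positivity))
    have hpow : F x ^ t = y := by rw [hxy, Real.rpow_inv_natCast_pow hy ht.ne']
    have h1 : maxCDF F t ⁻¹' Set.Iic y = Set.Iic x := by
      ext z
      simp only [Set.mem_preimage, Set.mem_Iic]
      rw [← hpow, ← hF.maxCDF_eq t hx hxb]
      exact ⟨fun h => not_lt.1 fun h' => (hF.maxCDF_lt ht hx hxb h').not_ge h,
        fun h => hF.monotone_maxCDF t h⟩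
    have h2 : Set.Iic y ∩ Set.Icc 0 1 = Set.Icc 0 y := by
      ext z
      simp only [Set.mem_inter_iff, Set.mem_Iic, Set.mem_Icc]
      constructor
      · exact fun h => ⟨h.2.1, h.1⟩
      · exact fun h => ⟨h.2, h.1, h.2.trans hy1.le⟩
    rw [h1, h2, hρ x hx hxb, hpow, Real.volume_Icc, sub_zero]
  · have h1 : maxCDF F t ⁻¹' Set.Iic y = Set.univ := by
      ext z
      simpa using (maxCDF_le_one F t z).trans hy1
    have h2 : Set.Iic y ∩ Set.Icc 0 1 = Set.Icc 0 1 :=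
      Set.inter_eq_right.2 fun z hz => hz.2.trans hy1
    rw [h1, h2, measure_univ, Real.volume_Icc]
    simp

/-- Supporting-line inequality for the convex function `(1 - F) ^ (-λ)`. -/
lemma LambdaRegular.rpow_mul_le {l : ℝ} (hl : 0 < l) (hF : IsCDF F f a b)
    (hreg : LambdaRegular l F f a b) {u v : ℝ} (hu : a ≤ u) (hub : (u : EReal) < b)
    (hv : a ≤ v) (hvb : (v : EReal) < b) :
    (1 - F v) ^ l * (1 + l * (v - u) / ((1 - F u) / f u)) ≤ (1 - F u) ^ l := by
  set c := (1 - F u) / f u with hc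
  set R : ℝ → ℝ := fun x => (1 - F x) ^ l * (1 + l * (x - u) / c) with hR
  have hcpos : 0 < c := div_pos (sub_pos.2 (hF.lt_one hu hub)) (hF.2.2.2.1 u hu hub).2
  have hder : ∀ x : ℝ, a ≤ x → (x : EReal) < b → HasDerivAt R
      (l * (1 - F x) ^ (l - 1) * f x / c * ((1 - F x) / f x - c - l * (x - u))) x := by
    intro x hx hxb
    obtain ⟨hd, hfx⟩ := hF.2.2.2.1 x hx hxb
    have hG : 0 < 1 - F x := sub_pos.2 (hF.lt_one hx hxb)
    have h1 := (hd.const_sub 1).rpow_const (p := l) (Or.inl hG.ne')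
    have h2 : HasDerivAt (fun x : ℝ => 1 + l * (x - u) / c) (l / c) x := by
      simpa using ((((hasDerivAt_id x).sub_const u).const_mul l).div_const c).const_add 1
    refine (h1.mul h2).congr_deriv ?_
    have h3 : (1 - F x) ^ l = (1 - F x) ^ (l - 1) * (1 - F x) := by
      rw [← Real.rpow_add_one hG.ne', sub_add_cancel]
    rw [h3]
    field_simp
    ring
  have hcoef : ∀ x : ℝ, a ≤ x → (x : EReal) < b → 0 ≤ l * (1 - F x) ^ (l - 1) * f x / c := by
    intro x hx hxb
    have hG : 0 < 1 - F x := sub_pos.2 (hF.lt_one hx hxb)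
    have := (hF.2.2.2.1 x hx hxb).2
    positivity
  have hRu : R u = (1 - F u) ^ l := by simp [hR]
  change R v ≤ _
  rw [← hRu]
  rcases le_total u v with huv | huv
  · have hmem : ∀ x ∈ Set.Icc u v, a ≤ x ∧ (x : EReal) < b := fun x hx =>
      ⟨hu.trans hx.1, (EReal.coe_le_coe_iff.2 hx.2).trans_lt hvb⟩
    have : AntitoneOn R (Set.Icc u v) := by
      refine antitoneOn_of_deriv_nonpos (convex_Icc _ _)
        (fun x hx => (hder x (hmem x hx).1 (hmem x hx).2).continuousAt.continuousWithinAt)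
        (fun x hx => (hder x (hmem x (interior_subset hx)).1
          (hmem x (interior_subset hx)).2).differentiableAt.differentiableWithinAt) fun x hx => ?_
      obtain ⟨hx1, hx2⟩ := hmem x (interior_subset hx)
      rw [(hder x hx1 hx2).deriv]
      refine mul_nonpos_of_nonneg_of_nonpos (hcoef x hx1 hx2) ?_
      have := hreg ⟨hu, hub⟩ ⟨hx1, hx2⟩ (interior_subset hx).1
      simp only at this
      linarith
    exact this ⟨le_rfl, huv⟩ ⟨huv, le_rfl⟩ huv
  · have hmem : ∀ x ∈ Set.Icc v u, a ≤ x ∧ (x : EReal) < b := fun x hx =>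
      ⟨hv.trans hx.1, (EReal.coe_le_coe_iff.2 hx.2).trans_lt hub⟩
    have : MonotoneOn R (Set.Icc v u) := by
      refine monotoneOn_of_deriv_nonneg (convex_Icc _ _)
        (fun x hx => (hder x (hmem x hx).1 (hmem x hx).2).continuousAt.continuousWithinAt)
        (fun x hx => (hder x (hmem x (interior_subset hx)).1
          (hmem x (interior_subset hx)).2).differentiableAt.differentiableWithinAt) fun x hx => ?_
      obtain ⟨hx1, hx2⟩ := hmem x (interior_subset hx)
      rw [(hder x hx1 hx2).deriv]
      refine mul_nonneg (hcoef x hx1 hx2) ?_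
      have := hreg ⟨hx1, hx2⟩ ⟨hu, hub⟩ (interior_subset hx).2
      simp only at this
      linarith
    exact this ⟨le_rfl, huv⟩ ⟨huv, le_rfl⟩ huv

lemma IsCDF.one_sub_maxCDF_le (hF : IsCDF F f a b) (t : ℕ) {x : ℝ} (hx : a ≤ x)
    (hxb : (x : EReal) < b) : 1 - maxCDF F t x ≤ t * (1 - F x) := by
  rw [hF.maxCDF_eq t hx hxb]
  have := one_add_mul_le_pow (a := F x - 1) (by linarith [hF.nonneg hx]) t
  rw [add_sub_cancel] at this
  linarith

lemma intervalIntegrable_one_sub_rpow {l : ℝ} (hl : l < 1) :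
    IntervalIntegrable (fun y : ℝ => (1 - y) ^ (-l)) volume 0 1 := by
  have := (intervalIntegral.intervalIntegrable_rpow' (a := 0) (b := 1)
    (r := -l) (by linarith)).comp_sub_left 1
  simpa using this.symm

lemma integral_one_sub_rpow {l : ℝ} (hl : l < 1) :
    ∫ y in Set.Icc (0 : ℝ) 1, (1 - y) ^ (-l) = (1 - l)⁻¹ := by
  rw [integral_Icc_eq_integral_Ioc, ← intervalIntegral.integral_of_le zero_le_one,
    intervalIntegral.integral_comp_sub_left (fun y : ℝ => y ^ (-l)) 1, sub_self, sub_zero,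
    integral_rpow (Or.inl (by linarith))]
  rw [Real.one_rpow, Real.zero_rpow (by linarith), sub_zero, one_div, neg_add_eq_sub]

/-- The bound for the maximum of `t` draws, in the case `λ > 0`. -/
lemma LambdaRegular.rpow_le_mul_one_sub {l : ℝ} (hl : 0 < l) (hl1 : l < 1) (hF : IsCDF F f a b)
    (hreg : LambdaRegular l F f a b) {t : ℕ} (ht : 0 < t) {ρ : Measure ℝ}
    [IsProbabilityMeasure ρ]
    (hρ : ∀ x : ℝ, a ≤ x → (x : EReal) < b → ρ (Set.Iic x) = ENNReal.ofReal (F x ^ t))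
    (hint : Integrable id ρ) :
    (1 - l) ^ (1 / l) ≤ t * (1 - F (∫ x, x ∂ρ)) := by
  set u := ∫ x, x ∂ρ with hu
  have hmeas := (hF.monotone_maxCDF t).measurable
  have hmap := hF.map_maxCDF ht hρ
  have hK : ∀ᵐ x ∂ρ, maxCDF F t x ∈ Set.Ioo (0 : ℝ) 1 := by
    refine ae_of_ae_map hmeas.aemeasurable ?_
    rw [hmap, ← restrict_Ioo_eq_restrict_Icc]
    exact ae_restrict_mem measurableSet_Ioo
  have hsupp : ∀ᵐ x ∂ρ, a ≤ x ∧ (x : EReal) < b := by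
    filter_upwards [hK] with x hx
    constructor
    · by_contra! h
      have h1 := hF.monotone_maxCDF t h.le
      rw [hF.maxCDF_eq t le_rfl hF.1, hF.2.2.1, zero_pow ht.ne'] at h1
      exact absurd hx.1 (not_lt.2 h1)
    · by_contra! h
      have := hF.one_le h
      have h2 := hx.2
      rw [maxCDF, min_eq_right this] at h2
      simp at h2
  have hua : a ≤ u := by
    obtain ⟨x, hx, hxu⟩ := exists_notMem_null_le_integral hint (ae_iff.1 hsupp)
    exact (not_not.1 hx).1.trans hxu
  have hub : (u : EReal) < b := by
    obtain ⟨x, hx, hxu⟩ := exists_notMem_null_integral_le hint (ae_iff.1 hsupp)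
    exact (EReal.coe_le_coe_iff.2 hxu).trans_lt (not_not.1 hx).2
  have hGu : 0 < 1 - F u := sub_pos.2 (hF.lt_one hua hub)
  set c := (1 - F u) / f u with hc
  have hint' : Integrable (fun y : ℝ => (1 - y) ^ (-l)) (ρ.map (maxCDF F t)) := by
    rw [hmap]
    exact (intervalIntegrable_iff_integrableOn_Icc_of_le zero_le_one).1
      (intervalIntegrable_one_sub_rpow hl1)
  have hintK : Integrable (fun x => (1 - maxCDF F t x) ^ (-l)) ρ :=
    hint'.comp_measurable hmeas
  have hEK : ∫ x, (1 - maxCDF F t x) ^ (-l) ∂ρ = (1 - l)⁻¹ := by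
    rw [← integral_one_sub_rpow hl1, ← hmap,
      integral_map hmeas.aemeasurable hint'.aestronglyMeasurable]
  have hle : ∀ᵐ x ∂ρ, 1 + l / c * (x - u) ≤
      (t * (1 - F u)) ^ l * (1 - maxCDF F t x) ^ (-l) := by
    filter_upwards [hsupp, hK] with x hx hKx
    have hG : 0 < 1 - F x := sub_pos.2 (hF.lt_one hx.1 hx.2)
    have hKpos : 0 < 1 - maxCDF F t x := sub_pos.2 hKx.2
    have h1 := hreg.rpow_mul_le hl hF hua hub hx.1 hx.2
    rw [mul_div_right_comm, ← hc] at h1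
    have h2 : (1 - maxCDF F t x) ^ l ≤ (t : ℝ) ^ l * (1 - F x) ^ l := by
      rw [← Real.mul_rpow (by positivity) hG.le]
      exact Real.rpow_le_rpow hKpos.le (hF.one_sub_maxCDF_le t hx.1 hx.2) hl.le
    rw [Real.mul_rpow (by positivity) hGu.le, Real.rpow_neg hKpos.le, ← div_eq_mul_inv,
      le_div_iff₀ (Real.rpow_pos_of_pos hKpos _)]
    rcases le_total (1 + l / c * (x - u)) 0 with h0 | h0
    · exact (mul_nonpos_of_nonpos_of_nonneg h0 (by positivity)).trans (by positivity)
    · calc (1 + l / c * (x - u)) * (1 - maxCDF F t x) ^ l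
          ≤ (1 + l / c * (x - u)) * ((t : ℝ) ^ l * (1 - F x) ^ l) := by gcongr
        _ = (t : ℝ) ^ l * ((1 - F x) ^ l * (1 + l / c * (x - u))) := by ring
        _ ≤ (t : ℝ) ^ l * (1 - F u) ^ l := by gcongr
  have hint2 : Integrable (fun x : ℝ => x) ρ := hint
  have hint3 : Integrable (fun x : ℝ => l / c * (x - u)) ρ :=
    (hint2.sub (integrable_const u)).const_mul _
  have hI := integral_mono_ae (g := fun x => (t * (1 - F u)) ^ l * (1 - maxCDF F t x) ^ (-l))
    (f := fun x => 1 + l / c * (x - u)) ((integrable_const (1 : ℝ)).add hint3)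
    (hintK.const_mul ((t * (1 - F u)) ^ l)) hle
  have hleft : ∫ x, (1 + l / c * (x - u)) ∂ρ = 1 := by
    rw [integral_add (integrable_const _) hint3, integral_const_mul,
      integral_sub hint2 (integrable_const u), ← hu]
    simp
  rw [hleft, integral_const_mul, hEK, ← div_eq_mul_inv, le_div_iff₀ (by linarith), one_mul] at hI
  have htG : 0 ≤ t * (1 - F u) := by positivity
  calc (1 - l) ^ (1 / l) ≤ ((t * (1 - F u)) ^ l) ^ (1 / l) :=
        Real.rpow_le_rpow (by linarith) hI (by positivity)
    _ = t * (1 - F u) := by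
        rw [← Real.rpow_mul htG, mul_one_div_cancel hl.ne', Real.rpow_one]

lemma LambdaRegular.mono {l m : ℝ} (hlm : l ≤ m) (hreg : LambdaRegular l F f a b) :
    LambdaRegular m F f a b := by
  intro x hx y hy hxy
  have h1 := hreg hx hy hxy
  have h2 := mul_le_mul_of_nonneg_left hxy (sub_nonneg.2 hlm)
  simp only at h1 ⊢
  linarith

/-- The bound for the maximum of `t` draws. -/
lemma LambdaRegular.cReg_le_mul_one_sub {l : ℝ} (hl : 0 ≤ l) (hl1 : l < 1) (hF : IsCDF F f a b)
    (hreg : LambdaRegular l F f a b) {t : ℕ} (ht : 0 < t) {ρ : Measure ℝ}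
    [IsProbabilityMeasure ρ]
    (hρ : ∀ x : ℝ, a ≤ x → (x : EReal) < b → ρ (Set.Iic x) = ENNReal.ofReal (F x ^ t))
    (hint : Integrable id ρ) :
    cReg l ≤ t * (1 - F (∫ x, x ∂ρ)) := by
  rcases hl.eq_or_lt with rfl | hl0
  · rw [cReg, if_pos rfl, ← Real.exp_neg]
    refine le_of_tendsto (Real.tendsto_one_add_div_pow_exp (-1)) ?_
    filter_upwards [eventually_gt_atTop 1] with k hk
    have hk' : (1 : ℝ) < k := by exact_mod_cast hk
    have := (hreg.mono (m := 1 / (k : ℝ)) (by positivity)).rpow_le_mul_one_sub (by positivity)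
      ((div_lt_one (by linarith)).2 hk') hF ht hρ hint
    rw [one_div_one_div, Real.rpow_natCast] at this
    rwa [neg_div, ← sub_eq_add_neg]
  · rw [cReg, if_neg hl0.ne']
    exact hreg.rpow_le_mul_one_sub hl0 hl1 hF ht hρ hint

end CDF

lemma natCeil_div_le_two_mul {n j : ℕ} (hj : 1 ≤ j) (hjn : j ≤ n) :
    (j : ℝ) * ⌈(n : ℝ) / j⌉₊ ≤ 2 * n := by
  have hj0 : (0 : ℝ) < j := by exact_mod_cast hj
  have h1 : (j : ℝ) ≤ n := by exact_mod_cast hjn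
  have h2 := Nat.ceil_lt_add_one (a := (n : ℝ) / j) (by positivity)
  have h3 : (j : ℝ) * (n / j + 1) = n + j := by field_simp
  nlinarith

theorem stmt7 (lam : ℝ) (hlam : lam ∈ Set.Ico (0:ℝ) 1)
    (F f : ℝ → ℝ) (a : ℝ) (b : EReal) (ha : 0 ≤ a)
    (μ : Measure ℝ)
    (hF : IsCDF F f a b) (hμ : InducedBy μ F a b)
    (hreg : LambdaRegular lam F f a b)
    (n j : ℕ) (hj : 1 ≤ j) (hjn : j ≤ n)
    (hint : Integrable (orderStat ⌈(n : ℝ) / j⌉₊ 1)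
      (Measure.pi fun _ : Fin ⌈(n : ℝ) / j⌉₊ => μ))
    (u : ℝ) (hu : u = orderStatExp μ 1 ⌈(n : ℝ) / j⌉₊) :
    (n : ℝ) * (1 - F u) ≥ ((j : ℝ) / 2) * cReg lam := by
  have hn : (0 : ℝ) < n := by exact_mod_cast hj.trans hjn
  have hj0 : (0 : ℝ) < j := by exact_mod_cast hj
  have hle := natCeil_div_le_two_mul hj hjn
  have ht : 0 < ⌈(n : ℝ) / j⌉₊ := Nat.ceil_pos.2 (by positivity)
  generalize ⌈(n : ℝ) / j⌉₊ = t at *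
  have := hμ.1
  have hmeas := measurable_orderStat_one ht
  set ρ := (Measure.pi fun _ : Fin t => μ).map (orderStat t 1) with hρdef
  have : IsProbabilityMeasure ρ := Measure.isProbabilityMeasure_map hmeas.aemeasurable
  have hρ : ∀ x : ℝ, a ≤ x → (x : EReal) < b → ρ (Set.Iic x) = ENNReal.ofReal (F x ^ t) := by
    intro x hx hxb
    rw [hρdef, map_orderStat_one_Iic ht, hμ.2 x hx hxb, ENNReal.ofReal_pow (hF.nonneg hx)]
  have hid : Integrable id ρ :=
    (integrable_map_measure aestronglyMeasurable_id hmeas.aemeasurable).2 hint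
  have hu' : u = ∫ x, x ∂ρ := by
    rw [hu, orderStatExp, hρdef, integral_map hmeas.aemeasurable measurable_id'.aestronglyMeasurable]
  have key := hreg.cReg_le_mul_one_sub hlam.1 hlam.2 hF ht hρ hid
  rw [← hu'] at key
  have hc : 0 ≤ cReg lam := by
    rw [cReg]
    split_ifs
    · positivity
    · exact Real.rpow_nonneg (by linarith [hlam.2]) _
  have ht' : (0 : ℝ) < t := by exact_mod_cast ht
  have hG : 0 ≤ 1 - F u := nonneg_of_mul_nonneg_right (hc.trans key) ht'
  have h1 := mul_le_mul_of_nonneg_left key hj0.le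
  have h2 := mul_le_mul_of_nonneg_right hle hG
  linarith
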